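/- arXiv:2103.08770 — 2 statements merged into one kernel-verified Lean document; each statement's English description precedes it below -/
import Mathlib

section
/- Let d ≥ 2 and 4/3 < γ < 2. For every Schwartz function v : ℝ^d → ℂ, the nonlinear free energy of the free evolution is finite: ∫_0^∞ Q(e^{isΔ} v) ds < ∞. -/
open MeasureTheory Complex
open scoped ENNReal NNReal FourierTransform

noncomputable section

/-- The free Schrödinger propagator `e^{itΔ}`:
`(e^{itΔ}φ)(x) = (4πit)^{-d/2} ∫ e^{i|x-y|²/(4t)} φ(y) dy`. -/
def schrod (d : ℕ) (t : ℝ) (φ : EuclideanSpace ℝ (Fin d) → ℂ)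
    (x : EuclideanSpace ℝ (Fin d)) : ℂ :=
  (((4 * Real.pi * t : ℝ) : ℂ) * Complex.I) ^ (-(d : ℂ) / 2) *
    ∫ y : EuclideanSpace ℝ (Fin d),
      Complex.exp (Complex.I * ((‖x - y‖ : ℝ) : ℂ) ^ 2 / ((4 * t : ℝ) : ℂ)) * φ y
/-- The Hartree potential energy functional
`Q(u) = (1/4) ∫∫ |x-y|^{-γ} |u(x)|² |u(y)|² dx dy`, valued in `[0,∞]`. -/
def hartreeQ (d : ℕ) (γ : ℝ) (u : EuclideanSpace ℝ (Fin d) → ℂ) : ℝ≥0∞ :=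
  (1 / 4 : ℝ≥0∞) *
    ∫⁻ x : EuclideanSpace ℝ (Fin d), ∫⁻ y : EuclideanSpace ℝ (Fin d),
      ENNReal.ofReal (‖x - y‖ ^ (-γ)) * (‖u x‖₊ : ℝ≥0∞) ^ 2 * (‖u y‖₊ : ℝ≥0∞) ^ 2


lemma fe_exp_growth : Function.HasTemperateGrowth (fun s : ℝ => cexp (I * (s : ℂ))) := by
  have hder : ∀ c : ℂ, ∀ n : ℕ, iteratedDeriv n (fun s : ℝ => cexp (I * (s : ℂ)))
      = fun s : ℝ => I ^ n * cexp (I * (s : ℂ)) := by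
    intro c n
    induction n with
    | zero => simp
    | succ n ih =>
      rw [iteratedDeriv_succ, ih]
      funext s
      have h1 : HasDerivAt (fun s : ℝ => cexp (I * (s : ℂ))) (cexp (I * (s : ℂ)) * (I * 1)) s :=
        ((Complex.ofRealCLM.hasDerivAt (x := s)).const_mul I).cexp
      rw [(h1.const_mul (I ^ n)).deriv]
      ring
  refine ⟨?_, fun n => ⟨0, 1, fun x => ?_⟩⟩
  · exact (contDiff_const.mul Complex.ofRealCLM.contDiff).cexp
  · rw [norm_iteratedFDeriv_eq_norm_iteratedDeriv, hder 0]
    simp [Complex.norm_exp]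

lemma fe_chirp_growth (d : ℕ) (a : ℝ) : Function.HasTemperateGrowth
    (fun x : EuclideanSpace ℝ (Fin d) => cexp (I * ((a * ‖x‖ ^ 2 : ℝ) : ℂ))) := by
  have h : Function.HasTemperateGrowth (fun x : EuclideanSpace ℝ (Fin d) => a * ‖x‖ ^ 2) :=
    (Function.HasTemperateGrowth.const a).mul (Function.hasTemperateGrowth_norm_sq _)
  exact fe_exp_growth.comp h

lemma fe_norm_prefactor {z : ℂ} (hz : z ≠ 0) (s : ℝ) :
    ‖z ^ (s : ℂ)‖ = ‖z‖ ^ s := by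
  rw [norm_cpow_of_ne_zero hz]; simp

lemma fe_prefactor (d : ℕ) {t : ℝ} (ht : 0 < t) :
    ‖(((4 * Real.pi * t : ℝ) : ℂ) * Complex.I) ^ (-(d : ℂ) / 2)‖
      = (4 * Real.pi * t) ^ (-(d : ℝ) / 2) := by
  have hpi := Real.pi_pos
  have h0 : (((4 * Real.pi * t : ℝ) : ℂ) * Complex.I) ≠ 0 := by
    apply mul_ne_zero _ I_ne_zero
    exact_mod_cast (by positivity : (4 * Real.pi * t) ≠ 0)
  have h1 : (-(d : ℂ) / 2) = ((-(d : ℝ) / 2 : ℝ) : ℂ) := by push_cast; ring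
  rw [h1, fe_norm_prefactor h0, norm_mul, norm_I, mul_one, norm_real, Real.norm_of_nonneg]
  positivity

lemma fe_schrod_fourier (d : ℕ) {t : ℝ} (ht : 0 < t)
    (v : SchwartzMap (EuclideanSpace ℝ (Fin d)) ℂ) :
    ∃ w : SchwartzMap (EuclideanSpace ℝ (Fin d)) ℂ, (∀ y, ‖w y‖ = ‖v y‖) ∧
      ∀ x, ‖schrod d t v x‖ = (4 * Real.pi * t) ^ (-(d : ℝ) / 2) *
        ‖(𝓕 w) ((4 * Real.pi * t)⁻¹ • x)‖ := by
  have hg := fe_chirp_growth d (4 * t)⁻¹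
  refine ⟨SchwartzMap.smulLeftCLM ℂ
    (fun x : EuclideanSpace ℝ (Fin d) => cexp (I * (((4 * t)⁻¹ * ‖x‖ ^ 2 : ℝ) : ℂ))) v,
    fun y => ?_, fun x => ?_⟩
  · rw [SchwartzMap.smulLeftCLM_apply_apply hg, norm_smul, mul_comm I, norm_exp_ofReal_mul_I,
      one_mul]
  · have hpi := Real.pi_pos
    rw [schrod, norm_mul, fe_prefactor d ht]
    congr 1
    rw [SchwartzMap.fourier_coe, Real.fourier_eq']
    have : ∀ y, cexp (I * ((‖x - y‖ : ℝ) : ℂ) ^ 2 / ((4 * t : ℝ) : ℂ)) * v y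
        = cexp (((4 * t)⁻¹ * ‖x‖ ^ 2 : ℝ) * I) *
          (cexp (((-2 * Real.pi * inner ℝ y ((4 * Real.pi * t)⁻¹ • x) : ℝ) : ℂ) * I) •
          (SchwartzMap.smulLeftCLM ℂ (fun x : EuclideanSpace ℝ (Fin d) =>
            cexp (I * (((4 * t)⁻¹ * ‖x‖ ^ 2 : ℝ) : ℂ))) v) y) := by
      intro y
      rw [SchwartzMap.smulLeftCLM_apply_apply hg, smul_eq_mul, smul_eq_mul, ← mul_assoc,
        ← mul_assoc, ← Complex.exp_add, ← Complex.exp_add]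
      congr 2
      have h1 : ((‖x - y‖ : ℝ) : ℂ) ^ 2 = ((‖x‖ ^ 2 - 2 * inner ℝ x y + ‖y‖ ^ 2 : ℝ) : ℂ) := by
        rw [← norm_sub_sq_real]; push_cast; rfl
      rw [h1, inner_smul_right, real_inner_comm]
      have ht' : (t : ℂ) ≠ 0 := by exact_mod_cast ht.ne'
      have hp' : (Real.pi : ℂ) ≠ 0 := by exact_mod_cast hpi.ne'
      push_cast
      field_simp
      ring
    simp_rw [this]
    rw [integral_const_mul, norm_mul, norm_exp_ofReal_mul_I, one_mul]

lemma fe_sup_large (d : ℕ) {t : ℝ} (ht : 0 < t)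
    (v : SchwartzMap (EuclideanSpace ℝ (Fin d)) ℂ) (x : EuclideanSpace ℝ (Fin d)) :
    ‖schrod d t v x‖ ≤ (4 * Real.pi * t) ^ (-(d : ℝ) / 2) * ∫ y, ‖v y‖ := by
  obtain ⟨w, hw, h⟩ := fe_schrod_fourier d ht v
  have hpi := Real.pi_pos
  rw [h]
  gcongr
  refine (SchwartzMap.norm_fourier_apply_le_toLp_one w _).trans ?_
  rw [SchwartzMap.norm_toLp_one]
  simp [hw]

lemma fe_lintegral_smul (d : ℕ) {c : ℝ} (hc : 0 < c) (f : EuclideanSpace ℝ (Fin d) → ℝ≥0∞) :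
    ∫⁻ x, f (c • x) = ENNReal.ofReal (c ^ (-(d : ℝ))) * ∫⁻ x, f x := by
  have h := Measure.map_addHaar_smul (volume : Measure (EuclideanSpace ℝ (Fin d))) hc.ne'
  have h2 := (Homeomorph.smulOfNeZero c hc.ne' :
    EuclideanSpace ℝ (Fin d) ≃ₜ _).measurableEmbedding.lintegral_map (μ := volume) f
  have h3 : Measure.map (⇑(Homeomorph.smulOfNeZero c hc.ne' : EuclideanSpace ℝ (Fin d) ≃ₜ _))
      volume = Measure.map (c • ·) volume := rfl
  rw [h3, h, lintegral_smul_measure] at h2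
  simp only [Homeomorph.smulOfNeZero_apply] at h2
  rw [← h2, smul_eq_mul, finrank_euclideanSpace_fin, Real.rpow_neg hc.le, Real.rpow_natCast,
    abs_of_pos (by positivity)]

lemma fe_L2 (d : ℕ) {t : ℝ} (ht : 0 < t)
    (v : SchwartzMap (EuclideanSpace ℝ (Fin d)) ℂ) :
    ∫⁻ x, (‖schrod d t v x‖₊ : ℝ≥0∞) ^ 2 = ENNReal.ofReal (∫ y, ‖v y‖ ^ 2) := by
  obtain ⟨w, hw, h⟩ := fe_schrod_fourier d ht v
  have hpi := Real.pi_pos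
  have hc : 0 < (4 * Real.pi * t) := by positivity
  have h1 : ∀ x, (‖schrod d t v x‖₊ : ℝ≥0∞) ^ 2 = ENNReal.ofReal ((4 * Real.pi * t) ^ (-(d : ℝ))) *
      ENNReal.ofReal (‖(𝓕 w) ((4 * Real.pi * t)⁻¹ • x)‖ ^ 2) := by
    intro x
    rw [← ENNReal.ofReal_mul (by positivity), ← enorm_eq_nnnorm, ← ofReal_norm,
      ← ENNReal.ofReal_pow (norm_nonneg _), h, mul_pow, ← Real.rpow_natCast, ← Real.rpow_mul hc.le]
    norm_num
  simp_rw [h1]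
  rw [lintegral_const_mul' _ _ ENNReal.ofReal_ne_top,
    fe_lintegral_smul d (inv_pos.2 hc) (fun x => ENNReal.ofReal (‖(𝓕 w : SchwartzMap (EuclideanSpace ℝ (Fin d)) ℂ) x‖ ^ 2)),
    ← ofReal_integral_eq_lintegral_ofReal, SchwartzMap.integral_norm_sq_fourier, ← mul_assoc,
    ← ENNReal.ofReal_mul (by positivity), ← Real.mul_rpow (by positivity) (by positivity),
    mul_inv_cancel₀ hc.ne']
  · simp [hw]
  · exact ((𝓕 w : SchwartzMap (EuclideanSpace ℝ (Fin d)) ℂ).memLp 2).integrable_norm_pow (by norm_num)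
  · exact Filter.Eventually.of_forall fun x => by positivity

lemma fe_gauss_bound (d : ℕ) {b : ℂ} (hb : 0 < b.re)
    (v : SchwartzMap (EuclideanSpace ℝ (Fin d)) ℂ) (x : EuclideanSpace ℝ (Fin d)) :
    (‖b‖ / Real.pi) ^ ((d : ℝ) / 2) * ‖∫ y, cexp (-b * (‖x - y‖ : ℂ) ^ 2) * v y‖
      ≤ ∫ y, ‖(𝓕 v : SchwartzMap (EuclideanSpace ℝ (Fin d)) ℂ) y‖ := by
  have hpi := Real.pi_pos
  have hp' : (Real.pi : ℂ) ≠ 0 := by exact_mod_cast hpi.ne'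
  have hb0 : b ≠ 0 := by rintro rfl; simp at hb
  set b' : ℂ := (Real.pi : ℂ) ^ 2 / b with hb'
  have hre : 0 < b'.re := by
    have : b' = ((Real.pi ^ 2 : ℝ) : ℂ) * b⁻¹ := by rw [hb']; push_cast; rfl
    rw [this, re_ofReal_mul, inv_re]
    have := normSq_pos.2 hb0
    positivity
  have J := GaussianFourier.integrable_cexp_neg_mul_sq_norm_add hre (2 * Real.pi * I) x
  have key : ∫ y, (𝓕 (fun w : EuclideanSpace ℝ (Fin d) =>
        cexp (-b' * ‖w‖ ^ 2 + 2 * Real.pi * I * inner ℝ x w))) y • v y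
      = ∫ y, cexp (-b' * ‖y‖ ^ 2 + 2 * Real.pi * I * inner ℝ x y) • (𝓕 (v : EuclideanSpace ℝ (Fin d) → ℂ)) y := by
    simpa using! (VectorFourier.integral_fourierIntegral_smul_eq_flip (L := innerₗ _)
      Real.continuous_fourierChar continuous_inner J v.integrable)
  have hL : ∀ y, (𝓕 (fun w : EuclideanSpace ℝ (Fin d) =>
        cexp (-b' * ‖w‖ ^ 2 + 2 * Real.pi * I * inner ℝ x w))) y • v y
      = (b / Real.pi) ^ (((d : ℝ) / 2 : ℝ) : ℂ) * (cexp (-b * (‖x - y‖ : ℂ) ^ 2) * v y) := by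
    intro y
    rw [fourier_gaussian_innerProductSpace' hre, smul_eq_mul, mul_assoc]
    have e1 : (Real.pi : ℂ) / b' = b / Real.pi := by rw [hb']; field_simp
    have e2 : -(Real.pi : ℂ) ^ 2 * (‖x - y‖ : ℂ) ^ 2 / b' = -b * (‖x - y‖ : ℂ) ^ 2 := by
      rw [hb']; field_simp
    rw [e1, e2]
    simp
  simp_rw [hL] at key
  rw [integral_const_mul] at key
  have h1 : (‖b‖ / Real.pi) ^ ((d : ℝ) / 2) = ‖(b / Real.pi) ^ (((d : ℝ) / 2 : ℝ) : ℂ)‖ := by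
    rw [fe_norm_prefactor (div_ne_zero hb0 hp'), norm_div, norm_real, Real.norm_of_nonneg hpi.le]
  rw [h1, ← norm_mul, key]
  refine norm_integral_le_of_norm_le ((𝓕 v : SchwartzMap (EuclideanSpace ℝ (Fin d)) ℂ).integrable.norm)
    (Filter.Eventually.of_forall fun y => ?_)
  rw [norm_smul, SchwartzMap.fourier_coe]
  refine mul_le_of_le_one_left (norm_nonneg _) ?_
  rw [norm_exp, Real.exp_le_one_iff]
  have : (-b' * (‖y‖ : ℂ) ^ 2 + 2 * Real.pi * I * (inner ℝ x y : ℝ)).re = -(b'.re * ‖y‖ ^ 2) := by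
    have e : (-b' * (‖y‖ : ℂ) ^ 2 + 2 * Real.pi * I * (inner ℝ x y : ℝ))
      = ((‖y‖ ^ 2 : ℝ) : ℂ) * (-b') + ((2 * Real.pi * inner ℝ x y : ℝ) : ℂ) * I := by
        push_cast; ring
    rw [e, add_re, re_ofReal_mul, re_ofReal_mul]
    simp; ring
  rw [this]
  have : 0 ≤ b'.re * ‖y‖ ^ 2 := by positivity
  linarith

lemma fe_sup_small (d : ℕ) {t : ℝ} (ht : 0 < t)
    (v : SchwartzMap (EuclideanSpace ℝ (Fin d)) ℂ) (x : EuclideanSpace ℝ (Fin d)) :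
    ‖schrod d t v x‖ ≤ ∫ y, ‖(𝓕 v : SchwartzMap (EuclideanSpace ℝ (Fin d)) ℂ) y‖ := by
  have hpi := Real.pi_pos
  let b : ℝ → ℂ := fun ε => (ε : ℂ) - ((4 * t)⁻¹ : ℝ) * I
  have hbc : Continuous b := by fun_prop
  have hre : ∀ ε, (b ε).re = ε := fun ε => by simp [b]
  have hlim : Filter.Tendsto (fun ε : ℝ => (‖b ε‖ / Real.pi) ^ ((d : ℝ) / 2) *
      ‖∫ y, cexp (-b ε * (‖x - y‖ : ℂ) ^ 2) * v y‖) (nhdsWithin 0 (Set.Ioi 0))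
      (nhds ((‖b 0‖ / Real.pi) ^ ((d : ℝ) / 2) *
      ‖∫ y, cexp (-b 0 * (‖x - y‖ : ℂ) ^ 2) * v y‖)) := by
    refine Filter.Tendsto.mul ?_ (Filter.Tendsto.norm ?_)
    · have : Continuous (fun ε : ℝ => (‖b ε‖ / Real.pi) ^ ((d : ℝ) / 2)) :=
        (hbc.norm.div_const _).rpow_const (fun _ => Or.inr (by positivity))
      exact (this.tendsto 0).mono_left nhdsWithin_le_nhds
    · refine tendsto_integral_filter_of_dominated_convergence (fun y => ‖v y‖) ?_ ?_
        v.integrable.norm ?_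
      · refine Filter.Eventually.of_forall fun ε => Continuous.aestronglyMeasurable ?_
        have := v.continuous
        fun_prop
      · filter_upwards [self_mem_nhdsWithin] with ε hε
        refine Filter.Eventually.of_forall fun y => ?_
        rw [norm_mul]
        refine mul_le_of_le_one_left (norm_nonneg _) ?_
        rw [norm_exp, Real.exp_le_one_iff]
        have : (-b ε * (‖x - y‖ : ℂ) ^ 2) = ((‖x - y‖ ^ 2 : ℝ) : ℂ) * (-b ε) := by
          push_cast; ring
        rw [this, re_ofReal_mul, neg_re, hre]
        have : 0 < ε := hε
        have : 0 ≤ ‖x - y‖ ^ 2 * ε := by positivity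
        linarith
      · refine Filter.Eventually.of_forall fun y => ?_
        have : Continuous (fun ε : ℝ => cexp (-b ε * (‖x - y‖ : ℂ) ^ 2) * v y) := by fun_prop
        exact (this.tendsto 0).mono_left nhdsWithin_le_nhds
  have hle := le_of_tendsto hlim (by
    filter_upwards [self_mem_nhdsWithin] with ε hε
    exact fe_gauss_bound d (by rw [hre]; exact hε) v x)
  refine le_trans (le_of_eq ?_) hle
  rw [schrod, norm_mul, fe_prefactor d ht]
  congr 1
  · have : ‖b 0‖ / Real.pi = (4 * Real.pi * t)⁻¹ := by
      have : ‖b 0‖ = (4 * t)⁻¹ := by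
        simp only [b, ofReal_zero, zero_sub, norm_neg, norm_mul, norm_I, mul_one, norm_real]
        exact Real.norm_of_nonneg (by positivity)
      rw [this]; field_simp
    rw [this, Real.inv_rpow (by positivity), ← Real.rpow_neg (by positivity), neg_div]
  · congr 2
    funext y
    congr 2
    simp only [b]
    push_cast
    field_simp
    ring

lemma fe_kernel (d : ℕ) (hd : 2 ≤ d) (γ : ℝ) (hγ2 : γ < 2) :
    ∫⁻ y in Metric.ball (0 : EuclideanSpace ℝ (Fin d)) 1, ENNReal.ofReal (‖y‖ ^ (-γ)) < ∞ := by
  have h2 : (2 : ℝ) ≤ d := by exact_mod_cast hd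
  have h : IntegrableOn (fun y : EuclideanSpace ℝ (Fin d) => ‖y‖ ^ (-γ)) (Metric.ball 0 1) := by
    refine integrableOn_ball_of_norm_le_rpow (C := 1) (α := γ) ?_ ?_ ?_ ?_
    · simp; omega
    · simp; linarith
    · exact Filter.Eventually.of_forall fun y => by
        rw [one_mul, Real.norm_of_nonneg (by positivity)]
    · exact (measurable_norm.pow_const _).aestronglyMeasurable
  exact h.lintegral_lt_top

lemma fe_kernel_scale (d : ℕ) (γ : ℝ) {R : ℝ} (hR : 0 < R) (x : EuclideanSpace ℝ (Fin d)) :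
    ∫⁻ y, (Metric.ball x R).indicator (fun y => ENNReal.ofReal (‖x - y‖ ^ (-γ))) y
      = ENNReal.ofReal (R ^ ((d : ℝ) - γ)) *
        ∫⁻ y in Metric.ball (0 : EuclideanSpace ℝ (Fin d)) 1, ENNReal.ofReal (‖y‖ ^ (-γ)) := by
  rw [← lintegral_indicator Metric.isOpen_ball.measurableSet]
  set g : EuclideanSpace ℝ (Fin d) → ℝ≥0∞ :=
    (Metric.ball (0 : EuclideanSpace ℝ (Fin d)) 1).indicator
      (fun y => ENNReal.ofReal (‖y‖ ^ (-γ))) with hg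
  have h1 : ∀ y, (Metric.ball x R).indicator (fun y => ENNReal.ofReal (‖x - y‖ ^ (-γ))) y
      = ENNReal.ofReal (R ^ (-γ)) * g (R⁻¹ • (y - x)) := by
    intro y
    have hn : ‖R⁻¹ • (y - x)‖ = R⁻¹ * ‖x - y‖ := by
      rw [norm_smul, norm_sub_rev, Real.norm_of_nonneg (by positivity)]
    have hiff : y ∈ Metric.ball x R ↔ R⁻¹ • (y - x) ∈ Metric.ball (0 : EuclideanSpace ℝ (Fin d)) 1 := by
      rw [mem_ball_zero_iff, hn, Metric.mem_ball, dist_eq_norm, norm_sub_rev, inv_mul_lt_iff₀ hR,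
        mul_one]
    by_cases hy : y ∈ Metric.ball x R
    · rw [hg, Set.indicator_of_mem hy, Set.indicator_of_mem (hiff.1 hy), hn,
        ← ENNReal.ofReal_mul (by positivity), ← Real.mul_rpow hR.le (by positivity),
        mul_inv_cancel_left₀ hR.ne']
    · rw [hg, Set.indicator_of_notMem hy, Set.indicator_of_notMem (fun h => hy (hiff.2 h)),
        mul_zero]
  simp_rw [h1]
  rw [lintegral_const_mul' _ _ ENNReal.ofReal_ne_top,
    lintegral_sub_right_eq_self (fun y => g (R⁻¹ • y)) x, fe_lintegral_smul d (inv_pos.2 hR),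
    ← mul_assoc, ← ENNReal.ofReal_mul (by positivity), Real.inv_rpow hR.le,
    ← Real.rpow_neg hR.le, neg_neg, ← Real.rpow_add hR, neg_add_eq_sub]

lemma fe_Q_bound (d : ℕ) (γ : ℝ) (hγ : 0 < γ) {R : ℝ} (hR : 0 < R)
    (u : EuclideanSpace ℝ (Fin d) → ℂ) {M A : ℝ≥0∞} (hM : M ≠ ∞) (hA : A ≠ ∞)
    (hu : ∀ x, (‖u x‖₊ : ℝ≥0∞) ^ 2 ≤ M) (hu2 : ∫⁻ x, (‖u x‖₊ : ℝ≥0∞) ^ 2 = A)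
    (hK : ∫⁻ y in Metric.ball (0 : EuclideanSpace ℝ (Fin d)) 1,
      ENNReal.ofReal (‖y‖ ^ (-γ)) < ∞) :
    hartreeQ d γ u ≤ A * (M * (ENNReal.ofReal (R ^ ((d : ℝ) - γ)) *
        ∫⁻ y in Metric.ball (0 : EuclideanSpace ℝ (Fin d)) 1, ENNReal.ofReal (‖y‖ ^ (-γ)))
        + ENNReal.ofReal (R ^ (-γ)) * A) := by
  set K := ∫⁻ y in Metric.ball (0 : EuclideanSpace ℝ (Fin d)) 1, ENNReal.ofReal (‖y‖ ^ (-γ))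
  have hin : ∀ x, ∫⁻ y, ENNReal.ofReal (‖x - y‖ ^ (-γ)) * (‖u x‖₊ : ℝ≥0∞) ^ 2 *
      (‖u y‖₊ : ℝ≥0∞) ^ 2 ≤ (‖u x‖₊ : ℝ≥0∞) ^ 2 * (M * (ENNReal.ofReal (R ^ ((d : ℝ) - γ)) * K)
        + ENNReal.ofReal (R ^ (-γ)) * A) := by
    intro x
    have hmeas : Measurable ((Metric.ball x R).indicator
        (fun y => ENNReal.ofReal (‖x - y‖ ^ (-γ)))) := by
      refine Measurable.indicator ?_ Metric.isOpen_ball.measurableSet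
      exact (((measurable_const.sub measurable_id).norm).pow_const _).ennreal_ofReal
    calc _ ≤ ∫⁻ y, (‖u x‖₊ : ℝ≥0∞) ^ 2 * (M * (Metric.ball x R).indicator
            (fun y => ENNReal.ofReal (‖x - y‖ ^ (-γ))) y
            + ENNReal.ofReal (R ^ (-γ)) * (‖u y‖₊ : ℝ≥0∞) ^ 2) := by
          refine lintegral_mono fun y => ?_
          rw [mul_comm (ENNReal.ofReal _), mul_assoc]
          refine mul_le_mul_right ?_ _
          by_cases hy : y ∈ Metric.ball x R
          · rw [Set.indicator_of_mem hy, mul_comm]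
            exact le_add_right (mul_le_mul_left (hu y) _)
          · refine le_add_left (mul_le_mul_left (ENNReal.ofReal_le_ofReal ?_) _)
            refine Real.rpow_le_rpow_of_nonpos hR ?_ (by linarith)
            rw [Metric.mem_ball, dist_eq_norm, norm_sub_rev, not_lt] at hy
            exact hy
      _ = _ := by
          rw [lintegral_const_mul' _ _ (by simp), lintegral_add_left (hmeas.const_mul M),
            lintegral_const_mul' _ _ hM, lintegral_const_mul' _ _ ENNReal.ofReal_ne_top, hu2,
            fe_kernel_scale d γ hR x]
  calc hartreeQ d γ u ≤ ∫⁻ x : EuclideanSpace ℝ (Fin d), ∫⁻ y : EuclideanSpace ℝ (Fin d),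
      ENNReal.ofReal (‖x - y‖ ^ (-γ)) * (‖u x‖₊ : ℝ≥0∞) ^ 2 * (‖u y‖₊ : ℝ≥0∞) ^ 2 := by
        unfold hartreeQ
        exact mul_le_of_le_one_left zero_le (by simp)
    _ ≤ _ := lintegral_mono hin
    _ = _ := by
        rw [lintegral_mul_const' _ _ ?_, hu2]
        have := hK.ne
        finiteness

/-- **Finiteness of the nonlinear free energy.** For `d ≥ 2` and `4/3 < γ < 2`, the
nonlinear free energy of the free evolution of any Schwartz function `v` is finite:
`∫₀^∞ Q(e^{isΔ}v) ds < ∞`. -/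
theorem free_energy_finite (d : ℕ) (hd : 2 ≤ d) (γ : ℝ) (hγ0 : 4 / 3 < γ) (hγ2 : γ < 2)
    (v : SchwartzMap (EuclideanSpace ℝ (Fin d)) ℂ) :
    (∫⁻ s in Set.Ioi (0 : ℝ), hartreeQ d γ (schrod d s ⇑v)) < ∞ := by
  have hpi := Real.pi_pos
  have hK := fe_kernel d hd γ hγ2
  set K := ∫⁻ y in Metric.ball (0 : EuclideanSpace ℝ (Fin d)) 1, ENNReal.ofReal (‖y‖ ^ (-γ)) with hKdef
  set A : ℝ≥0∞ := ENNReal.ofReal (∫ y, ‖v y‖ ^ 2) with hA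
  set M0 : ℝ≥0∞ := ENNReal.ofReal ((∫ y, ‖(𝓕 v : SchwartzMap (EuclideanSpace ℝ (Fin d)) ℂ) y‖) ^ 2)
    with hM0
  set N : ℝ≥0∞ := ENNReal.ofReal ((∫ y, ‖v y‖) ^ 2) with hN
  have hAt : A ≠ ∞ := ENNReal.ofReal_ne_top
  have hMt : M0 ≠ ∞ := ENNReal.ofReal_ne_top
  have hNt : N ≠ ∞ := ENNReal.ofReal_ne_top
  have hKt : K ≠ ∞ := hK.ne
  have hsq : ∀ z : ℂ, ∀ c : ℝ, ‖z‖ ≤ c → (‖z‖₊ : ℝ≥0∞) ^ 2 ≤ ENNReal.ofReal (c ^ 2) := by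
    intro z c h
    rw [← enorm_eq_nnnorm, ← ofReal_norm, ← ENNReal.ofReal_pow (norm_nonneg _)]
    exact ENNReal.ofReal_le_ofReal (by gcongr)
  have hsmall : ∀ s ∈ Set.Ioc (0 : ℝ) 1, hartreeQ d γ (schrod d s ⇑v) ≤ A * (M0 * K + A) := by
    intro s hs
    have := fe_Q_bound d γ (by linarith) one_pos (schrod d s ⇑v) hMt hAt
      (fun x => hsq _ _ (fe_sup_small d hs.1 v x)) (fe_L2 d hs.1 v) hK
    simpa using this
  have hlarge : ∀ s ∈ Set.Ioi (1 : ℝ), hartreeQ d γ (schrod d s ⇑v)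
      ≤ A * (N * K + A) * ENNReal.ofReal (s ^ (-γ)) := by
    intro s hs
    have hs0 : 0 < s := lt_trans one_pos hs
    have hsup : ∀ x, (‖schrod d s v x‖₊ : ℝ≥0∞) ^ 2 ≤ ENNReal.ofReal (s ^ (-(d : ℝ))) * N := by
      intro x
      refine (hsq _ _ (fe_sup_large d hs0 v x)).trans ?_
      rw [hN, ← ENNReal.ofReal_mul (by positivity), mul_pow, ← Real.rpow_natCast (_ ^ _),
        ← Real.rpow_mul (by positivity)]
      refine ENNReal.ofReal_le_ofReal (mul_le_mul_of_nonneg_right ?_ (by positivity))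
      have : -(d : ℝ) / 2 * ((2 : ℕ) : ℝ) = -(d : ℝ) := by push_cast; ring
      rw [this]
      refine Real.rpow_le_rpow_of_nonpos hs0 ?_ (by simp)
      nlinarith [Real.pi_gt_three]
    have := fe_Q_bound d γ (by linarith) hs0 (schrod d s ⇑v)
      (ENNReal.mul_ne_top ENNReal.ofReal_ne_top hNt) hAt hsup (fe_L2 d hs0 v) hK
    refine this.trans (le_of_eq ?_)
    have e : ENNReal.ofReal (s ^ (-γ)) =
        ENNReal.ofReal (s ^ (-(d : ℝ))) * ENNReal.ofReal (s ^ ((d : ℝ) - γ)) := by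
      rw [← ENNReal.ofReal_mul (by positivity), ← Real.rpow_add hs0]
      congr 2; ring
    rw [← hKdef]
    calc _ = A * ((ENNReal.ofReal (s ^ (-(d : ℝ))) * ENNReal.ofReal (s ^ ((d : ℝ) - γ))) * (N * K)
          + ENNReal.ofReal (s ^ (-γ)) * A) := by ring
      _ = _ := by rw [← e]; ring
  rw [← Set.Ioc_union_Ioi_eq_Ioi (zero_le_one' ℝ)]
  refine (lintegral_union_le _ _ _).trans_lt (ENNReal.add_lt_top.2 ⟨?_, ?_⟩)
  · refine (setLIntegral_mono' measurableSet_Ioc hsmall).trans_lt ?_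
    rw [setLIntegral_const]
    simp only [Real.volume_Ioc]
    have : A * (M0 * K + A) * ENNReal.ofReal (1 - 0) ≠ ∞ := by finiteness
    exact this.lt_top
  · refine (setLIntegral_mono' measurableSet_Ioi hlarge).trans_lt ?_
    rw [lintegral_const_mul' _ _ (by finiteness)]
    have h := (integrableOn_Ioi_rpow_of_lt (a := -γ) (by linarith) one_pos).lintegral_lt_top
    exact ENNReal.mul_lt_top (by finiteness) h
end
end

section
/- Let d ≥ 2, 4/3 < γ < 2, and r = 4d/(2d-γ). There exists a constant C = C(d,γ) > 0 such that for every A ∈ [0,1], every real t ≠ 0, and every Schwartz function u : ℝ^d → ℂ, ‖u‖_{L^r(ℝ^d)} ≤ C |t|^{-Aγ/4} ‖u‖_{L²(ℝ^d)}^{1-γ/4} ‖J(t)u‖_{L²(ℝ^d)}^{Aγ/4} ‖∇u‖_{L²(ℝ^d)}^{(1-A)γ/4}. -/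
open MeasureTheory Complex
open scoped ENNReal NNReal

noncomputable section
/-- The Galilean vector field `J(t)u(x) = x u(x) + 2it ∇u(x)`, as a `ℂ^d`-valued function. -/
def Jfield (d : ℕ) (t : ℝ) (u : EuclideanSpace ℝ (Fin d) → ℂ)
    (x : EuclideanSpace ℝ (Fin d)) : EuclideanSpace ℂ (Fin d) :=
  (WithLp.equiv 2 (Fin d → ℂ)).symm
    (fun j => (x j : ℂ) * u x +
      2 * Complex.I * (t : ℂ) * fderiv ℝ u x (EuclideanSpace.single j 1))
/-- The gradient of `u : ℝ^d → ℂ`, as a `ℂ^d`-valued function (components `∂_j u`). -/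
def gradVec (d : ℕ) (u : EuclideanSpace ℝ (Fin d) → ℂ)
    (x : EuclideanSpace ℝ (Fin d)) : EuclideanSpace ℂ (Fin d) :=
  (WithLp.equiv 2 (Fin d → ℂ)).symm (fun j => fderiv ℝ u x (EuclideanSpace.single j 1))

theorem interp_aux {α : Type*} [MeasurableSpace α] {μ : Measure α} {f : α → ℂ}
    (hf : AEStronglyMeasurable f μ) {p q r l : ℝ} (hp : 0 < p) (hq : 0 < q) (hr : 0 < r)
    (hl0 : 0 ≤ l) (hl1 : l ≤ 1) (h : 1 / r = (1 - l) / p + l / q) :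
    eLpNorm f (ENNReal.ofReal r) μ ≤
      eLpNorm f (ENNReal.ofReal p) μ ^ (1 - l) * eLpNorm f (ENNReal.ofReal q) μ ^ l := by
  have e : ∀ s : ℝ, 0 < s → eLpNorm f (ENNReal.ofReal s) μ = (∫⁻ a, ‖f a‖ₑ ^ s ∂μ) ^ (1 / s) := by
    intro s hs
    rw [eLpNorm_eq_lintegral_rpow_enorm_toReal (by simpa using hs) ENNReal.ofReal_ne_top,
      ENNReal.toReal_ofReal hs.le]
  rw [e r hr, e p hp, e q hq]
  have ha : 0 ≤ r * (1 - l) / p := by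
    have : 0 ≤ 1 - l := by linarith
    positivity
  have hb : 0 ≤ r * l / q := by positivity
  have hab : r * (1 - l) / p + r * l / q = 1 := by
    have : r * (1 - l) / p + r * l / q = r * ((1 - l) / p + l / q) := by ring
    rw [this, ← h]; field_simp
  have key := ENNReal.lintegral_mul_norm_pow_le (μ := μ) (f := fun a => ‖f a‖ₑ ^ p)
    (g := fun a => ‖f a‖ₑ ^ q) (hf.enorm.pow_const _) (hf.enorm.pow_const _) ha hb hab
  have e2 : ∀ a, (‖f a‖ₑ ^ p) ^ (r * (1 - l) / p) * (‖f a‖ₑ ^ q) ^ (r * l / q) = ‖f a‖ₑ ^ r := by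
    intro a
    rw [← ENNReal.rpow_mul, ← ENNReal.rpow_mul, ← ENNReal.rpow_add_of_nonneg]
    · congr 1; field_simp; ring
    · positivity
    · positivity
  simp only [e2] at key
  calc _ ≤ ((∫⁻ a, ‖f a‖ₑ ^ p ∂μ) ^ (r * (1 - l) / p) *
        (∫⁻ a, ‖f a‖ₑ ^ q ∂μ) ^ (r * l / q)) ^ (1 / r) := by gcongr
    _ = _ := by
      rw [ENNReal.mul_rpow_of_nonneg _ _ (by positivity), ← ENNReal.rpow_mul, ← ENNReal.rpow_mul,
        ← ENNReal.rpow_mul, ← ENNReal.rpow_mul]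
      congr 2 <;> field_simp

theorem sobolev_aux (d : ℕ) (hd : 2 ≤ d) {p : ℝ≥0}
    (hp : NNReal.HolderConjugate d p) :
    ∃ K : ℝ≥0, ∀ W : EuclideanSpace ℝ (Fin d) → ℝ, ContDiff ℝ 1 W →
      eLpNorm W 1 volume ≠ ⊤ →
      eLpNorm W p volume ≤ K * eLpNorm (fderiv ℝ W) 1 volume := by
  have hp' : NNReal.HolderConjugate (Module.finrank ℝ (EuclideanSpace ℝ (Fin d))) p := by
    simpa using hp
  refine ⟨eLpNormLESNormFDerivOneConst (volume : Measure (EuclideanSpace ℝ (Fin d))) p, ?_⟩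
  intro W hW hW1
  set K := eLpNormLESNormFDerivOneConst (volume : Measure (EuclideanSpace ℝ (Fin d))) p
  let χ : ContDiffBump (0 : EuclideanSpace ℝ (Fin d)) := ⟨1, 2, by norm_num, by norm_num⟩
  have hχ : ContDiff ℝ 1 χ := χ.contDiff
  obtain ⟨M, hM⟩ : ∃ M : ℝ, ∀ x, ‖fderiv ℝ χ x‖ ≤ M :=
    (χ.hasCompactSupport.fderiv (𝕜 := ℝ)).exists_bound_of_continuous
      (hχ.continuous_fderiv (by norm_num))
  have hM0 : 0 ≤ M := (norm_nonneg _).trans (hM 0)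
  let c : ℕ → ℝ := fun n => 1 / ((n : ℝ) + 1)
  have hc0 : ∀ n, 0 < c n := fun n => by positivity
  have hc : Filter.Tendsto c Filter.atTop (nhds 0) := tendsto_one_div_add_atTop_nhds_zero_nat
  let X : ℕ → EuclideanSpace ℝ (Fin d) → ℝ := fun n x => χ (c n • x)
  have hXd : ∀ n, ContDiff ℝ 1 (X n) := fun n => hχ.comp (contDiff_const_smul (c n))
  have hXf : ∀ n x, ‖fderiv ℝ (X n) x‖ ≤ c n * M := by
    intro n x
    have : HasFDerivAt (X n) ((fderiv ℝ χ (c n • x)).comp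
        (c n • ContinuousLinearMap.id ℝ (EuclideanSpace ℝ (Fin d)))) x := by
      have h1 : HasFDerivAt (fun y : EuclideanSpace ℝ (Fin d) => c n • y)
        (c n • ContinuousLinearMap.id ℝ (EuclideanSpace ℝ (Fin d))) x :=
        (hasFDerivAt_id x).const_smul (c n)
      exact ((hχ.differentiable (by norm_num)) (c n • x)).hasFDerivAt.comp x h1
    rw [this.fderiv, ContinuousLinearMap.comp_smul, ContinuousLinearMap.comp_id, norm_smul,
      Real.norm_of_nonneg (hc0 n).le]
    exact mul_le_mul_of_nonneg_left (hM _) (hc0 n).le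
  have hXc : ∀ n, HasCompactSupport (X n) := fun n =>
    χ.hasCompactSupport.comp_homeomorph (Homeomorph.smulOfNeZero (c n) (hc0 n).ne')
  have hX1 : ∀ n x, ‖X n x‖ ≤ 1 := fun n x => by
    rw [Real.norm_of_nonneg χ.nonneg]; exact χ.le_one
  let w : ℕ → EuclideanSpace ℝ (Fin d) → ℝ := fun n x => X n x * W x
  have hwd : ∀ n, ContDiff ℝ 1 (w n) := fun n => (hXd n).mul hW
  have hwc : ∀ n, HasCompactSupport (w n) := fun n => (hXc n).mul_right
  have hlim : ∀ x, Filter.Tendsto (fun n => w n x) Filter.atTop (nhds (W x)) := by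
    intro x
    have h1 : Filter.Tendsto (fun n => X n x) Filter.atTop (nhds (χ 0)) := by
      refine (χ.continuous.tendsto 0).comp ?_
      simpa using hc.smul_const x
    have h2 : χ 0 = 1 := χ.one_of_mem_closedBall (by simp [χ])
    rw [h2] at h1
    simpa using h1.mul_const (W x)
  have hbound : ∀ n, eLpNorm (w n) p volume ≤ K * (eLpNorm (fderiv ℝ W) 1 volume +
      ENNReal.ofReal (c n * M) * eLpNorm W 1 volume) := by
    intro n
    refine (eLpNorm_le_eLpNorm_fderiv_one volume (hwd n) (hwc n) hp').trans ?_
    gcongr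
    have hWc : Continuous (fderiv ℝ W) := hW.continuous_fderiv (by norm_num)
    calc eLpNorm (fderiv ℝ (w n)) 1 volume
        ≤ eLpNorm (fun x => ‖fderiv ℝ W x‖ + (c n * M) • ‖W x‖) 1 volume := by
          refine eLpNorm_mono_real fun x => ?_
          have := ((hXd n).differentiable (by norm_num) x).hasFDerivAt.mul
            (hW.differentiable (by norm_num) x).hasFDerivAt
          rw [show fderiv ℝ (w n) x = _ from this.fderiv]
          refine (norm_add_le _ _).trans ?_
          rw [norm_smul, norm_smul, smul_eq_mul]
          have a1 := mul_le_mul_of_nonneg_right (hX1 n x) (norm_nonneg (fderiv ℝ W x))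
          have a2 := mul_le_mul_of_nonneg_left (hXf n x) (norm_nonneg (W x))
          linarith
      _ ≤ eLpNorm (fun x => ‖fderiv ℝ W x‖) 1 volume +
          eLpNorm (fun x => (c n * M) • ‖W x‖) 1 volume :=
          eLpNorm_add_le hWc.norm.aestronglyMeasurable
            (show Continuous (fun x => (c n * M) • ‖W x‖) by
              have := hW.continuous.norm
              fun_prop).aestronglyMeasurable le_rfl
      _ = _ := by
        rw [eLpNorm_norm]
        congr 1
        have := eLpNorm_const_smul (c n * M) (fun x => ‖W x‖) 1
          (volume : Measure (EuclideanSpace ℝ (Fin d)))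
        rw [eLpNorm_norm, Real.enorm_of_nonneg (mul_nonneg (hc0 n).le hM0)] at this
        exact this
  refine (Lp.eLpNorm_lim_le_liminf_eLpNorm
    (fun n => (hwd n).continuous.aestronglyMeasurable) W (Filter.Eventually.of_forall hlim)).trans ?_
  refine (Filter.liminf_le_liminf (Filter.Eventually.of_forall hbound)).trans (le_of_eq ?_)
  apply Filter.Tendsto.liminf_eq
  have t1 : Filter.Tendsto (fun n => ENNReal.ofReal (c n * M) * eLpNorm W 1 volume)
      Filter.atTop (nhds 0) := by
    have : Filter.Tendsto (fun n => ENNReal.ofReal (c n * M)) Filter.atTop (nhds 0) := by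
      simpa using ENNReal.tendsto_ofReal (hc.mul_const M)
    simpa using ENNReal.Tendsto.mul_const this (Or.inr hW1)
  have t2 := t1.const_add (eLpNorm (fderiv ℝ W) 1 volume)
  rw [add_zero] at t2
  exact ENNReal.Tendsto.const_mul t2 (Or.inr ENNReal.coe_ne_top)

theorem fderiv_bound (d : ℕ) (L : EuclideanSpace ℝ (Fin d) →L[ℝ] ℝ) (a : ℂ)
    (z : EuclideanSpace ℂ (Fin d))
    (h : ∀ j, L (EuclideanSpace.single j 1) = 2 * ((starRingEnd ℂ) a * z j).re) :
    ‖L‖ ≤ 2 * ‖a‖ * ‖z‖ := by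
  refine L.opNorm_le_bound (by positivity) fun v => ?_
  have hv : v = ∑ j, v j • EuclideanSpace.single j (1 : ℝ) := by
    ext i
    simp [Finset.sum_apply, Pi.single_apply]
  have : L v = ∑ j, v j * (2 * ((starRingEnd ℂ) a * z j).re) := by
    conv_lhs => rw [hv]
    simp [map_sum, h]
  rw [this]
  calc ‖∑ j, v j * (2 * ((starRingEnd ℂ) a * z j).re)‖
      ≤ ∑ j, ‖v j * (2 * ((starRingEnd ℂ) a * z j).re)‖ := norm_sum_le _ _
    _ ≤ ∑ j, 2 * ‖a‖ * (‖v j‖ * ‖z j‖) := by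
        refine Finset.sum_le_sum fun j _ => ?_
        have h1 : |((starRingEnd ℂ) a * z j).re| ≤ ‖a‖ * ‖z j‖ := by
          refine (Complex.abs_re_le_norm _).trans ?_
          simp
        rw [norm_mul, norm_mul, Real.norm_eq_abs ((starRingEnd ℂ) a * z j).re, Real.norm_two]
        nlinarith [norm_nonneg (v j), mul_le_mul_of_nonneg_left h1 (norm_nonneg (v j))]
    _ = 2 * ‖a‖ * ∑ j, ‖v j‖ * ‖z j‖ := by rw [Finset.mul_sum]
    _ ≤ 2 * ‖a‖ * (‖v‖ * ‖z‖) := by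
        gcongr
        rw [EuclideanSpace.norm_eq, EuclideanSpace.norm_eq]
        exact Real.sum_mul_le_sqrt_mul_sqrt _ _ _
    _ = _ := by ring

theorem normSq_fderiv (d : ℕ) (u : SchwartzMap (EuclideanSpace ℝ (Fin d)) ℂ)
    (x v : EuclideanSpace ℝ (Fin d)) :
    fderiv ℝ (fun y => ‖u y‖ ^ 2) x v = 2 * ((starRingEnd ℂ) (u x) * fderiv ℝ u x v).re := by
  have hu : HasFDerivAt (⇑u) (fderiv ℝ u x) x := u.differentiableAt.hasFDerivAt
  rw [hu.norm_sq.fderiv]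
  simp [Complex.inner, mul_comm]
  ring

theorem holder_aux (d : ℕ) (u : SchwartzMap (EuclideanSpace ℝ (Fin d)) ℂ)
    (z : EuclideanSpace ℝ (Fin d) → EuclideanSpace ℂ (Fin d)) (hz : Continuous z)
    (h : ∀ x j, ((starRingEnd ℂ) (u x) * fderiv ℝ u x (EuclideanSpace.single j 1)).re
      = ((starRingEnd ℂ) (u x) * z x j).re) :
    eLpNorm (fderiv ℝ (fun y => ‖u y‖ ^ 2)) 1 volume ≤
      2 * eLpNorm (⇑u) 2 volume * eLpNorm z 2 volume := by
  have hb : ∀ x, ‖fderiv ℝ (fun y => ‖u y‖ ^ 2) x‖ ≤ 2 * ‖u x‖ * ‖z x‖ := fun x =>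
    fderiv_bound d _ _ _ fun j => by rw [normSq_fderiv, h]
  refine (eLpNorm_mono_real hb).trans ?_
  have := eLpNorm_le_eLpNorm_mul_eLpNorm'_of_norm (p := 2) (q := 2) (r := 1) (μ := volume)
    (f := ⇑u) (g := z) u.continuous.aestronglyMeasurable hz.aestronglyMeasurable
    (fun a b => 2 * ‖a‖ * ‖b‖) 2 (Filter.Eventually.of_forall fun x => by simp)
  simpa using this

theorem gradVec_continuous (d : ℕ) (u : SchwartzMap (EuclideanSpace ℝ (Fin d)) ℂ) :
    Continuous (gradVec d ⇑u) := by
  have h : Continuous (fderiv ℝ (⇑u)) := (u.smooth 1).continuous_fderiv (by norm_num)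
  unfold gradVec
  refine (PiLp.continuous_toLp 2 _).comp (continuous_pi fun j => ?_)
  exact h.clm_apply continuous_const

theorem Jfield_continuous (d : ℕ) (t : ℝ) (u : SchwartzMap (EuclideanSpace ℝ (Fin d)) ℂ) :
    Continuous (Jfield d t ⇑u) := by
  have h : Continuous (fderiv ℝ (⇑u)) := (u.smooth 1).continuous_fderiv (by norm_num)
  have hu := u.continuous
  unfold Jfield
  refine (PiLp.continuous_toLp 2 _).comp (continuous_pi fun j => ?_)
  have h2 : Continuous fun x => fderiv ℝ u x (EuclideanSpace.single j 1) :=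
    h.clm_apply continuous_const
  fun_prop

theorem bound_grad (d : ℕ) (u : SchwartzMap (EuclideanSpace ℝ (Fin d)) ℂ) :
    eLpNorm (fderiv ℝ (fun y => ‖u y‖ ^ 2)) 1 volume ≤
      2 * eLpNorm (⇑u) 2 volume * eLpNorm (gradVec d ⇑u) 2 volume :=
  holder_aux d u _ (gradVec_continuous d u) fun x j => by simp [gradVec]

theorem bound_J (d : ℕ) (t : ℝ) (ht : t ≠ 0) (u : SchwartzMap (EuclideanSpace ℝ (Fin d)) ℂ) :
    eLpNorm (fderiv ℝ (fun y => ‖u y‖ ^ 2)) 1 volume ≤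
      2 * eLpNorm (⇑u) 2 volume *
        (ENNReal.ofReal |t|⁻¹ * eLpNorm (Jfield d t ⇑u) 2 volume) := by
  have htc : (t : ℂ) ≠ 0 := by exact_mod_cast ht
  have h := holder_aux d u (fun x => (2 * Complex.I * (t : ℂ))⁻¹ • Jfield d t (⇑u) x)
    (by have := Jfield_continuous d t u; fun_prop) fun x j => by
      have e : (2 * Complex.I * (t : ℂ))⁻¹ * ((x j : ℂ) * u x +
          2 * Complex.I * (t : ℂ) * fderiv ℝ u x (EuclideanSpace.single j 1)) =
          fderiv ℝ u x (EuclideanSpace.single j 1) +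
            (-((x j / (2 * t) : ℝ) : ℂ) * Complex.I) * u x := by
        push_cast
        field_simp
        linear_combination ((x j : ℂ) * u x) * Complex.I_sq
      simp only [Jfield, PiLp.smul_apply, smul_eq_mul]
      change _ = ((starRingEnd ℂ) (u x) * ((2 * Complex.I * (t : ℂ))⁻¹ * ((x j : ℂ) * u x +
          2 * Complex.I * (t : ℂ) * fderiv ℝ u x (EuclideanSpace.single j 1)))).re
      rw [e, mul_add, Complex.add_re]
      have : ((starRingEnd ℂ) (u x) * ((-((x j / (2 * t) : ℝ) : ℂ) * Complex.I) * u x)).re = 0 := by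
        simp only [Complex.mul_re, Complex.mul_im, Complex.conj_re, Complex.conj_im,
          Complex.neg_re, Complex.neg_im, Complex.ofReal_re, Complex.ofReal_im, Complex.I_re,
          Complex.I_im]
        ring
      rw [this, add_zero]
  refine h.trans ?_
  gcongr
  have := eLpNorm_const_smul ((2 * Complex.I * (t : ℂ))⁻¹) (Jfield d t ⇑u) 2
    (volume : Measure (EuclideanSpace ℝ (Fin d)))
  refine this.le.trans ?_
  gcongr
  rw [← ofReal_norm]
  apply ENNReal.ofReal_le_ofReal
  rw [norm_inv]
  apply inv_anti₀ (abs_pos.2 ht)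
  simp
  linarith [abs_nonneg t]

theorem interpolated_decay_estimate (d : ℕ) (hd : 2 ≤ d) (γ : ℝ) (hγ0 : 4 / 3 < γ)
    (hγ2 : γ < 2) :
    ∃ C > (0 : ℝ), ∀ A : ℝ, 0 ≤ A → A ≤ 1 → ∀ (t : ℝ), t ≠ 0 →
      ∀ u : SchwartzMap (EuclideanSpace ℝ (Fin d)) ℂ,
        eLpNorm (⇑u) (ENNReal.ofReal (4 * d / (2 * d - γ))) volume ≤
          ENNReal.ofReal (C * |t| ^ (-(A * γ / 4))) *
            eLpNorm (⇑u) 2 volume ^ (1 - γ / 4) *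
            eLpNorm (Jfield d t ⇑u) 2 volume ^ (A * γ / 4) *
            eLpNorm (gradVec d ⇑u) 2 volume ^ ((1 - A) * γ / 4) := by
  have hd2 : (2 : ℝ) ≤ d := by exact_mod_cast hd
  have hd1 : (0 : ℝ) < d - 1 := by linarith
  set p : ℝ≥0 := (d : ℝ≥0).conjExponent with hpdef
  have hp : NNReal.HolderConjugate d p :=
    NNReal.HolderConjugate.conjExponent (by exact_mod_cast hd)
  have hpr : (p : ℝ) = d / (d - 1) := by
    have := hp.coe.conjugate_eq
    simpa using this
  have hp0 : (0 : ℝ) < p := by rw [hpr]; positivity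
  obtain ⟨K, hK⟩ := sobolev_aux d hd hp
  refine ⟨(2 * ((K : ℝ) + 1)) ^ (γ / 4), by positivity, ?_⟩
  intro A hA0 hA1 t ht u
  have ht0 : 0 < |t| := abs_pos.2 ht
  have hW : ContDiff ℝ 1 (fun y => ‖u y‖ ^ 2) := (u.smooth 1).norm_sq ℝ
  set N := eLpNorm (⇑u) 2 volume with hN
  set X := eLpNorm (⇑u) (ENNReal.ofReal (2 * p)) volume with hX
  set g := eLpNorm (gradVec d ⇑u) 2 volume with hg
  set j := eLpNorm (Jfield d t ⇑u) 2 volume with hj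
  set B := eLpNorm (fderiv ℝ (fun y => ‖u y‖ ^ 2)) 1 volume with hB
  have hNtop : N ≠ ⊤ := (u.memLp 2 volume).2.ne
  have hsq : ∀ q : ℝ≥0∞, eLpNorm (fun y => ‖u y‖ ^ 2) q volume =
      eLpNorm (⇑u) (q * ENNReal.ofReal 2) volume ^ (2 : ℝ) := by
    intro q
    rw [← eLpNorm_norm_rpow (⇑u) (by norm_num : (0 : ℝ) < 2)]
    simp
  have hX2 : X ^ (2 : ℝ) ≤ K * B := by
    have h1 := hK _ hW (by
      rw [hsq]
      simpa using hNtop)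
    rw [hsq] at h1
    have : (p : ℝ≥0∞) * ENNReal.ofReal 2 = ENNReal.ofReal (2 * p) := by
      rw [mul_comm 2 (p : ℝ), ENNReal.ofReal_mul hp0.le, ENNReal.ofReal_coe_nnreal]
    rwa [this] at h1
  have hB1 : B ≤ 2 * N * g := bound_grad d u
  have hB2 : B ≤ 2 * N * (ENNReal.ofReal |t|⁻¹ * j) := bound_J d t ht u
  have hA1' : 0 ≤ 1 - A := by linarith
  have hBA : B ≤ 2 * N * ((ENNReal.ofReal |t|⁻¹ * j) ^ A * g ^ (1 - A)) := by
    calc B = B ^ A * B ^ (1 - A) := by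
          rw [← ENNReal.rpow_add_of_nonneg _ _ hA0 hA1']; simp
      _ ≤ (2 * N * (ENNReal.ofReal |t|⁻¹ * j)) ^ A * (2 * N * g) ^ (1 - A) := by gcongr
      _ = ((2 * N) ^ A * (2 * N) ^ (1 - A)) *
          ((ENNReal.ofReal |t|⁻¹ * j) ^ A * g ^ (1 - A)) := by
          rw [ENNReal.mul_rpow_of_nonneg _ _ hA0, ENNReal.mul_rpow_of_nonneg _ _ hA1']
          ring
      _ = _ := by
          rw [← ENNReal.rpow_add_of_nonneg _ _ hA0 hA1']; simp
  have hint : eLpNorm (⇑u) (ENNReal.ofReal (4 * d / (2 * d - γ))) volume ≤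
      N ^ (1 - γ / 2) * X ^ (γ / 2) := by
    have hden : 0 < 2 * (d : ℝ) - γ := by linarith
    have := interp_aux (μ := (volume : Measure (EuclideanSpace ℝ (Fin d)))) (f := ⇑u)
      u.continuous.aestronglyMeasurable (p := 2) (q := 2 * p)
      (r := 4 * d / (2 * d - γ)) (l := γ / 2) (by norm_num) (by positivity) (by positivity)
      (by linarith) (by linarith) (by
        rw [hpr]
        field_simp
        ring)
    rwa [show ENNReal.ofReal (2 : ℝ) = 2 by simp] at this
  have hq0 : 0 ≤ γ / 4 := by linarith
  have hXg : X ^ (γ / 2) ≤ (ENNReal.ofReal (2 * ((K : ℝ) + 1)) * N *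
      ((ENNReal.ofReal |t|⁻¹ * j) ^ A * g ^ (1 - A))) ^ (γ / 4) := by
    have : X ^ (γ / 2) = (X ^ (2 : ℝ)) ^ (γ / 4) := by
      rw [← ENNReal.rpow_mul]; congr 1; ring
    rw [this]
    gcongr
    refine hX2.trans ?_
    have hKe : (K : ℝ≥0∞) * 2 ≤ ENNReal.ofReal (2 * ((K : ℝ) + 1)) := by
      have : (K : ℝ≥0∞) * 2 = ENNReal.ofReal (K * 2) := by
        rw [ENNReal.ofReal_mul (by positivity)]; simp
      rw [this]
      apply ENNReal.ofReal_le_ofReal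
      linarith
    calc (K : ℝ≥0∞) * B ≤ K * (2 * N * ((ENNReal.ofReal |t|⁻¹ * j) ^ A * g ^ (1 - A))) := by gcongr
      _ = (K * 2) * N * ((ENNReal.ofReal |t|⁻¹ * j) ^ A * g ^ (1 - A)) := by ring
      _ ≤ _ := by gcongr
  refine hint.trans ((mul_le_mul_right hXg _).trans (le_of_eq ?_))
  rw [ENNReal.mul_rpow_of_nonneg _ _ hq0, ENNReal.mul_rpow_of_nonneg _ _ hq0,
    ENNReal.mul_rpow_of_nonneg _ _ hq0, ENNReal.mul_rpow_of_nonneg _ _ hA0,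
    ENNReal.mul_rpow_of_nonneg _ _ hq0, ← ENNReal.rpow_mul, ← ENNReal.rpow_mul,
    ← ENNReal.rpow_mul, ENNReal.ofReal_rpow_of_nonneg (by positivity) hq0,
    ENNReal.ofReal_rpow_of_nonneg (by positivity) (by positivity),
    ENNReal.ofReal_mul (by positivity)]
  have e1 : |t|⁻¹ ^ (A * (γ / 4)) = |t| ^ (-(A * γ / 4)) := by
    rw [Real.inv_rpow ht0.le, ← Real.rpow_neg ht0.le]; congr 1; ring
  have e2 : N ^ (1 - γ / 4) = N ^ (1 - γ / 2) * N ^ (γ / 4) := by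
    rw [← ENNReal.rpow_add_of_nonneg _ _ (by linarith) hq0]; congr 1; ring
  rw [e1, e2, mul_div_assoc, mul_div_assoc]
  ring
end
end
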